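/- arXiv:2509.16653 — 5 statements merged into one kernel-verified Lean document; each statement's English description precedes it below -/
import Mathlib

section
/- Let G be a finite simple graph on vertex set V, let λ be a real number with λ > 1, and define F(x) = Σ_{v ∈ V} (1 − x(v)) + λ · Σ_{v ∈ V} (1 − (1 − x(v)) · ∏_{u ∈ N(v)} (1 − x(u))) for x : V → {0,1}. Then the maximizers of F over all x : V → {0,1} are exactly the indicator functions of minimum dominating sets of G; i.e., F(x*) = max_x F(x) if and only if {v ∈ V : x*(v) = 1} is a dominating set of G of minimum cardinality. -/
open Finset

/-- A finset `D` is a dominating set of `G` if every vertex is in `D`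
or adjacent to at least one vertex of `D`. -/
def IsDominatingSet {V : Type*} (G : SimpleGraph V) (D : Finset V) : Prop :=
  ∀ v, v ∈ D ∨ ∃ u ∈ D, G.Adj v u

/-- The domination number: the minimum cardinality of a dominating set of `G`. -/
noncomputable def dominationNumber {V : Type*} [Fintype V] (G : SimpleGraph V) : ℕ :=
  sInf {k | ∃ D : Finset V, IsDominatingSet G D ∧ D.card = k}

/-- The auxiliary-qubit-free objective function
`F(x) = ∑_v (1 - x v) + λ ∑_v (1 - (1 - x v) ∏_{u ∈ N(v)} (1 - x u))`,
evaluated in `ℝ`. -/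
noncomputable def mdsObjective {V : Type*} [Fintype V] (G : SimpleGraph V)
    [DecidableRel G.Adj] (lam : ℝ) (x : V → ℤ) : ℝ :=
  (∑ v, (1 - (x v : ℝ))) +
    lam * ∑ v, (1 - (1 - (x v : ℝ)) * ∏ u ∈ G.neighborFinset v, (1 - (x u : ℝ)))

/-- The vertices neither in `D` nor adjacent to a vertex of `D`. -/
def undominated {V : Type*} [Fintype V] [DecidableEq V] (G : SimpleGraph V)
    [DecidableRel G.Adj] (D : Finset V) : Finset V :=
  univ.filter fun v => ¬ (v ∈ D ∨ ∃ u ∈ D, G.Adj v u)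

theorem undominated_eq_empty_iff {V : Type*} [Fintype V] [DecidableEq V] {G : SimpleGraph V}
    [DecidableRel G.Adj] {D : Finset V} : undominated G D = ∅ ↔ IsDominatingSet G D := by
  simp only [undominated, filter_eq_empty_iff, mem_univ, true_implies, not_not, IsDominatingSet]

theorem isDominatingSet_union_undominated {V : Type*} [Fintype V] [DecidableEq V]
    (G : SimpleGraph V) [DecidableRel G.Adj] (D : Finset V) :
    IsDominatingSet G (D ∪ undominated G D) := by
  intro v
  by_cases h : v ∈ D ∨ ∃ u ∈ D, G.Adj v u
  · exact h.imp (mem_union_left _) fun ⟨u, hu, huv⟩ => ⟨u, mem_union_left _ hu, huv⟩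
  · exact Or.inl (mem_union_right _ (mem_filter.2 ⟨mem_univ v, h⟩))

theorem IsDominatingSet.dominationNumber_le {V : Type*} [Fintype V] {G : SimpleGraph V}
    {D : Finset V} (h : IsDominatingSet G D) : dominationNumber G ≤ D.card :=
  Nat.sInf_le ⟨D, h, rfl⟩

theorem exists_isDominatingSet_card_eq_dominationNumber {V : Type*} [Fintype V]
    (G : SimpleGraph V) : ∃ D : Finset V, IsDominatingSet G D ∧ D.card = dominationNumber G :=
  Nat.sInf_mem (s := {k | ∃ D : Finset V, IsDominatingSet G D ∧ D.card = k})
    ⟨_, univ, fun v => Or.inl (mem_univ v), rfl⟩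

theorem dominationNumber_le_card_add_card_undominated {V : Type*} [Fintype V] [DecidableEq V]
    (G : SimpleGraph V) [DecidableRel G.Adj] (D : Finset V) :
    dominationNumber G ≤ D.card + (undominated G D).card :=
  (isDominatingSet_union_undominated G D).dominationNumber_le.trans (card_union_le _ _)

theorem mdsObjective_eq {V : Type*} [Fintype V] [DecidableEq V] (G : SimpleGraph V)
    [DecidableRel G.Adj] (lam : ℝ) {x : V → ℤ} (hx : ∀ v, x v = 0 ∨ x v = 1) :
    mdsObjective G lam x = (Fintype.card V - #{v | x v = 1} : ℝ) +
      lam * (Fintype.card V - #(undominated G {v | x v = 1})) := by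
  have hone : ∀ v, (1 - (x v : ℝ)) = if x v = 1 then 0 else 1 := by
    intro v
    rcases hx v with h | h <;> simp [h]
  have hdom : ∀ v, (1 - (x v : ℝ)) * ∏ u ∈ G.neighborFinset v, (1 - (x u : ℝ)) =
      if v ∈ undominated G {v | x v = 1} then 1 else 0 := by
    intro v
    simp only [undominated, mem_filter, mem_univ, true_and]
    split_ifs with h
    · rcases h with h | ⟨u, hu, huv⟩
      · simp [h]
      · rw [prod_eq_zero ((G.mem_neighborFinset v u).2 huv) (by simp [hu]), mul_zero]
    · push Not at h
      rw [prod_eq_one, hone, if_neg h.1, one_mul]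
      intro u hu
      rw [hone, if_neg fun hu1 => h.2 u hu1 ((G.mem_neighborFinset v u).1 hu)]
  have hsum : ∑ v, (x v : ℝ) = #{v | x v = 1} := by
    rw [card_filter, Nat.cast_sum]
    refine sum_congr rfl fun v _ => ?_
    rcases hx v with h | h <;> simp [h]
  unfold mdsObjective
  simp only [hdom, sum_sub_distrib, hsum]
  simp

/-- For `λ > 1`, the maximizers of `F` over `{0,1}`-valued `x`
are exactly the indicator functions of minimum dominating sets of `G`. -/
theorem mdsObjective_maximizers {V : Type*} [Fintype V] [DecidableEq V]
    (G : SimpleGraph V) [DecidableRel G.Adj] (lam : ℝ) (hlam : 1 < lam)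
    (xstar : V → ℤ) (hxstar : ∀ v, xstar v = 0 ∨ xstar v = 1) :
    (∀ x : V → ℤ, (∀ v, x v = 0 ∨ x v = 1) →
        mdsObjective G lam x ≤ mdsObjective G lam xstar) ↔
      (IsDominatingSet G (Finset.univ.filter fun v => xstar v = 1) ∧
        (Finset.univ.filter fun v => xstar v = 1).card = dominationNumber G) := by
  set S : Finset V := univ.filter fun v => xstar v = 1 with hS
  constructor
  · intro hmax
    obtain ⟨D, hD, hcard⟩ := exists_isDominatingSet_card_eq_dominationNumber G
    have hind : ∀ v, (if v ∈ D then 1 else 0 : ℤ) = 0 ∨ (if v ∈ D then 1 else 0 : ℤ) = 1 :=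
      fun v => (ite_eq_or_eq (v ∈ D) (1 : ℤ) 0).symm
    have hfilter : (univ.filter fun v => (if v ∈ D then 1 else 0 : ℤ) = 1) = D := by
      ext v
      simp
    have hle := hmax _ hind
    rw [mdsObjective_eq G lam hind, mdsObjective_eq G lam hxstar, hfilter,
      undominated_eq_empty_iff.2 hD, hcard, ← hS, card_empty, Nat.cast_zero] at hle
    have hγ : (dominationNumber G : ℝ) ≤ #S + #(undominated G S) := by
      exact_mod_cast dominationNumber_le_card_add_card_undominated G S
    have hzero : (#(undominated G S) : ℝ) = 0 := by
      have hnonneg : (0 : ℝ) ≤ #(undominated G S) := Nat.cast_nonneg _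
      nlinarith
    have hdom : IsDominatingSet G S :=
      undominated_eq_empty_iff.1 (card_eq_zero.1 (Nat.cast_eq_zero.1 hzero))
    refine ⟨hdom, le_antisymm ?_ hdom.dominationNumber_le⟩
    rw [hzero] at hle
    exact_mod_cast (by linarith : (#S : ℝ) ≤ dominationNumber G)
  · rintro ⟨hdom, hcard⟩ x hx
    rw [mdsObjective_eq G lam hx, mdsObjective_eq G lam hxstar, ← hS,
      undominated_eq_empty_iff.2 hdom, hcard, card_empty, Nat.cast_zero]
    set T : Finset V := univ.filter fun v => x v = 1
    have hγ : (dominationNumber G : ℝ) ≤ #T + #(undominated G T) := by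
      exact_mod_cast dominationNumber_le_card_add_card_undominated G T
    have hnonneg : (0 : ℝ) ≤ #(undominated G T) := Nat.cast_nonneg _
    nlinarith
end

section
/- Let G be a finite simple graph on vertex set V with |V| = n, let λ be a real number with λ > 1, and define F(x) = Σ_{v ∈ V} (1 − x(v)) + λ · Σ_{v ∈ V} (1 − (1 − x(v)) · ∏_{u ∈ N(v)} (1 − x(u))) for x : V → {0,1}. Then the maximum of F over all x : V → {0,1} equals (n − γ(G)) + λ·n, where γ(G) is the domination number of G. -/
open Finset

open Classical in
/-- The vertices that are neither in `D` nor adjacent to a vertex of `D`. -/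
noncomputable def undominatedVertices {V : Type*} [Fintype V] (G : SimpleGraph V)
    (D : Finset V) : Finset V :=
  {v | ¬ (v ∈ D ∨ ∃ u ∈ D, G.Adj v u)}

theorem mem_undominatedVertices {V : Type*} [Fintype V] {G : SimpleGraph V}
    {D : Finset V} {v : V} :
    v ∈ undominatedVertices G D ↔ ¬ (v ∈ D ∨ ∃ u ∈ D, G.Adj v u) := by
  simp [undominatedVertices]

theorem IsDominatingSet.undominatedVertices_eq_empty {V : Type*} [Fintype V]
    {G : SimpleGraph V} {D : Finset V} (hD : IsDominatingSet G D) :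
    undominatedVertices G D = ∅ :=
  Finset.eq_empty_of_forall_notMem fun v hv => mem_undominatedVertices.1 hv (hD v)

theorem IsDominatingSet.dominationNumber_le_card {V : Type*} [Fintype V]
    {G : SimpleGraph V} {D : Finset V} (hD : IsDominatingSet G D) :
    dominationNumber G ≤ #D :=
  Nat.sInf_le ⟨D, hD, rfl⟩

theorem exists_isDominatingSet_card_eq {V : Type*} [Fintype V] (G : SimpleGraph V) :
    ∃ D : Finset V, IsDominatingSet G D ∧ #D = dominationNumber G :=
  Nat.sInf_mem (s := {k | ∃ D : Finset V, IsDominatingSet G D ∧ #D = k})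
    ⟨_, univ, fun v => Or.inl (mem_univ v), rfl⟩

theorem dominationNumber_le_card_add_card_undominatedVertices {V : Type*} [Fintype V]
    (G : SimpleGraph V) (D : Finset V) :
    dominationNumber G ≤ #D + #(undominatedVertices G D) := by
  classical
  have hdom : IsDominatingSet G (D ∪ undominatedVertices G D) := by
    intro v
    by_cases hv : v ∈ D ∨ ∃ u ∈ D, G.Adj v u
    · exact hv.imp (mem_union_left _) fun ⟨u, hu, huv⟩ => ⟨u, mem_union_left _ hu, huv⟩
    · exact Or.inl (mem_union_right _ (mem_undominatedVertices.2 hv))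
  exact hdom.dominationNumber_le_card.trans (card_union_le _ _)

/-- The objective at the indicator function of `D`, in terms of the sizes of `D` and of the
set of vertices that `D` does not dominate. -/
theorem mdsObjective_eq_of_indicator {V : Type*} [Fintype V] (G : SimpleGraph V)
    [DecidableRel G.Adj] (lam : ℝ) {x : V → ℤ} {D : Finset V}
    (hmem : ∀ v ∈ D, x v = 1) (hnotMem : ∀ v ∉ D, x v = 0) :
    mdsObjective G lam x = ((Fintype.card V : ℝ) - #D) +
      lam * ((Fintype.card V : ℝ) - #(undominatedVertices G D)) := by
  classical
  have hx : ∀ v, (x v : ℝ) = if v ∈ D then 1 else 0 := fun v => by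
    split_ifs with hv
    · simp [hmem v hv]
    · simp [hnotMem v hv]
  have hprod : ∀ v, (1 - (x v : ℝ)) * ∏ u ∈ G.neighborFinset v, (1 - (x u : ℝ)) =
      if v ∈ undominatedVertices G D then 1 else 0 := fun v => by
    split_ifs with hv
    · rw [mem_undominatedVertices, not_or] at hv
      rw [hnotMem v hv.1, prod_eq_one]
      · simp
      · intro u hu
        rw [hnotMem u fun huD => hv.2 ⟨u, huD, (G.mem_neighborFinset v u).1 hu⟩]
        simp
    · rw [mem_undominatedVertices, not_not] at hv
      rcases hv with hv | ⟨u, hu, huv⟩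
      · simp [hmem v hv]
      · rw [prod_eq_zero ((G.mem_neighborFinset v u).2 huv) (by simp [hmem u hu]), mul_zero]
  simp_rw [mdsObjective, hprod, hx]
  simp [sum_sub_distrib]

/-- For `λ > 1`, the maximum of `F` over all `{0,1}`-valued
`x : V → {0,1}` equals `(n - γ(G)) + λ·n`, where `n = |V|` and `γ(G)` is the
domination number of `G`. -/
theorem mdsObjective_max_value {V : Type*} [Fintype V]
    (G : SimpleGraph V) [DecidableRel G.Adj] (lam : ℝ) (hlam : 1 < lam) :
    IsGreatest {r : ℝ | ∃ x : V → ℤ, (∀ v, x v = 0 ∨ x v = 1) ∧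
        r = mdsObjective G lam x}
      (((Fintype.card V : ℝ) - (dominationNumber G : ℝ)) +
        lam * (Fintype.card V : ℝ)) := by
  classical
  constructor
  · obtain ⟨D, hD, hcard⟩ := exists_isDominatingSet_card_eq G
    refine ⟨fun v => if v ∈ D then 1 else 0, fun v => by by_cases hv : v ∈ D <;> simp [hv], ?_⟩
    rw [mdsObjective_eq_of_indicator G lam (D := D) (fun v hv => if_pos hv)
      (fun v hv => if_neg hv), hD.undominatedVertices_eq_empty, hcard]
    simp
  · rintro r ⟨x, hx, rfl⟩
    set D : Finset V := {v | x v = 1} with hD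
    rw [mdsObjective_eq_of_indicator G lam (D := D) (fun v hv => by simpa [hD] using hv)
      (fun v hv => (hx v).resolve_right (by simpa [hD] using hv))]
    have hle : (dominationNumber G : ℝ) ≤ #D + #(undominatedVertices G D) := by
      exact_mod_cast dominationNumber_le_card_add_card_undominatedVertices G D
    have hmul := le_mul_of_one_le_left
      (Nat.cast_nonneg (α := ℝ) #(undominatedVertices G D)) hlam.le
    linarith
end

section
/- Let d ≥ 1 be a natural number, let L = ⌊log₂ d⌋, and let a be an integer with 0 ≤ a ≤ d + 1. Then there exist binary surplus variables y_0, …, y_L ∈ {0,1} such that 1 − a + Σ_{k=0}^{L} 2^k · y_k = 0 if and only if a ≥ 1. Consequently, the Dinneen–Hua penalty term (1 − a + Σ_{k=0}^{L} 2^k y_k)² can be made zero by a choice of surplus variables exactly when the domination constraint a ≥ 1 holds. -/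
open Finset

theorem Nat.sum_range_two_pow_mul_div_mod (n m : ℕ) :
    ∑ k ∈ Finset.range m, 2 ^ k * (n / 2 ^ k % 2) = n % 2 ^ m := by
  induction m with
  | zero => simp [Nat.mod_one]
  | succ m ih => rw [Finset.sum_range_succ, ih, Nat.mod_pow_succ]

theorem exists_binary_sum_range_eq {n m : ℕ} (h : n < 2 ^ m) :
    ∃ y : ℕ → ℤ, (∀ k, y k = 0 ∨ y k = 1) ∧ ∑ k ∈ Finset.range m, 2 ^ k * y k = n := by
  refine ⟨fun k => ((n / 2 ^ k % 2 : ℕ) : ℤ), fun k => ?_, ?_⟩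
  · beta_reduce
    exact_mod_cast Nat.mod_two_eq_zero_or_one (n / 2 ^ k)
  · beta_reduce
    exact_mod_cast (Nat.sum_range_two_pow_mul_div_mod n m).trans (Nat.mod_eq_of_lt h)

/-- For `d ≥ 1`, `L = ⌊log₂ d⌋`, and an integer `a` with
`0 ≤ a ≤ d + 1`, there exist binary surplus variables `y_0, …, y_L ∈ {0,1}` with
`1 - a + ∑_{k=0}^{L} 2^k y_k = 0` iff `a ≥ 1`; consequently the Dinneen–Hua
penalty term `(1 - a + ∑_{k=0}^{L} 2^k y_k)²` can be made zero by a choice of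
surplus variables exactly when the domination constraint `a ≥ 1` holds. -/
theorem dinneen_hua_surplus_exists (d : ℕ) (hd : 1 ≤ d) (a : ℤ)
    (ha0 : 0 ≤ a) (ha1 : a ≤ (d : ℤ) + 1) :
    ((∃ y : ℕ → ℤ, (∀ k, y k = 0 ∨ y k = 1) ∧
        1 - a + ∑ k ∈ Finset.range (Nat.log 2 d + 1), 2 ^ k * y k = 0) ↔ 1 ≤ a) ∧
      ((∃ y : ℕ → ℤ, (∀ k, y k = 0 ∨ y k = 1) ∧
        (1 - a + ∑ k ∈ Finset.range (Nat.log 2 d + 1), 2 ^ k * y k) ^ 2 = 0) ↔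
        1 ≤ a) := by
  simp only [sq_eq_zero_iff, and_self]
  constructor
  · rintro ⟨y, hy, h⟩
    have hsum : 0 ≤ ∑ k ∈ Finset.range (Nat.log 2 d + 1), 2 ^ k * y k :=
      Finset.sum_nonneg fun k _ => mul_nonneg (by positivity)
        (by rcases hy k with h | h <;> simp [h])
    linarith
  · intro ha
    have hd2 : d < 2 ^ (Nat.log 2 d + 1) := Nat.lt_pow_succ_log_self one_lt_two d
    obtain ⟨y, hy, h⟩ := exists_binary_sum_range_eq
      (show (a - 1).toNat < 2 ^ (Nat.log 2 d + 1) by omega)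
    exact ⟨y, hy, by rw [h]; omega⟩
end

section
/- Let d ≥ 2 be a natural number and let L = ⌊log₂ d⌋. Define S(y) = Σ_{k=0}^{L−1} 2^k · y_k + (d + 1 − 2^L) · y_L for binary variables y_0, …, y_L ∈ {0,1}. Then the set of values attained by S, namely {S(y) : y ∈ {0,1}^{L+1}}, is exactly the set of integers {0, 1, …, d}; in particular the maximum value of S(y) is d. -/
open Finset

/-- The binary digits of `m` below position `n` recover `m % 2 ^ n`. -/
theorem sum_range_two_pow_mul_digit (m n : ℕ) :
    ∑ k ∈ range n, 2 ^ k * (m / 2 ^ k % 2) = m % 2 ^ n := by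
  induction n with
  | zero => simp [Nat.mod_one]
  | succ n ih => rw [sum_range_succ, ih, Nat.mod_pow_succ]

/-- Integers in `[0, 2 ^ n)` are binary sums on `n` bits, with the bit at position `n` free. -/
theorem exists_binary_sum_range {n : ℕ} {s b : ℤ} (hs : 0 ≤ s) (hsn : s < 2 ^ n)
    (hb : b = 0 ∨ b = 1) :
    ∃ y : ℕ → ℤ, (∀ k, y k = 0 ∨ y k = 1) ∧ ∑ k ∈ range n, 2 ^ k * y k = s ∧ y n = b := by
  lift s to ℕ using hs
  have hs' : s < 2 ^ n := by exact_mod_cast hsn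
  refine ⟨fun k => if k = n then b else ((s / 2 ^ k % 2 : ℕ) : ℤ), fun k => ?_, ?_, if_pos rfl⟩
  · dsimp only
    split_ifs
    · exact hb
    · exact_mod_cast Nat.mod_two_eq_zero_or_one _
  · have h := sum_range_two_pow_mul_digit s n
    rw [Nat.mod_eq_of_lt hs'] at h
    conv_rhs => rw [← h]
    push_cast
    exact sum_congr rfl fun k hk => by rw [if_neg (mem_range.mp hk).ne]

/-- A binary sum on `n` bits lies in `[0, 2 ^ n)`. -/
theorem binary_sum_range_mem_Ico {y : ℕ → ℤ} (hy : ∀ k, y k = 0 ∨ y k = 1) (n : ℕ) :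
    ∑ k ∈ range n, 2 ^ k * y k ∈ Set.Ico (0 : ℤ) (2 ^ n) := by
  induction n with
  | zero => simp
  | succ n ih =>
    have hpow : (0 : ℤ) < 2 ^ n := by positivity
    rw [sum_range_succ, pow_succ]
    obtain ⟨h0, h1⟩ := ih
    rcases hy n with h | h <;> rw [h] <;> constructor <;> linarith

/-- For `d ≥ 2` and `L = ⌊log₂ d⌋`, the Pan–Lu surplus
expression `S(y) = ∑_{k=0}^{L-1} 2^k y_k + (d + 1 - 2^L) y_L` over binary
variables `y ∈ {0,1}^{L+1}` attains exactly the integer values `{0, 1, …, d}`;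
in particular, its maximum value is `d`. -/
theorem pan_lu_surplus_range (d : ℕ) (hd : 2 ≤ d) :
    ({s : ℤ | ∃ y : ℕ → ℤ, (∀ k, y k = 0 ∨ y k = 1) ∧
        s = ∑ k ∈ Finset.range (Nat.log 2 d), 2 ^ k * y k +
          ((d : ℤ) + 1 - 2 ^ (Nat.log 2 d)) * y (Nat.log 2 d)} =
      {s : ℤ | 0 ≤ s ∧ s ≤ (d : ℤ)}) ∧
      IsGreatest {s : ℤ | ∃ y : ℕ → ℤ, (∀ k, y k = 0 ∨ y k = 1) ∧
          s = ∑ k ∈ Finset.range (Nat.log 2 d), 2 ^ k * y k +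
            ((d : ℤ) + 1 - 2 ^ (Nat.log 2 d)) * y (Nat.log 2 d)} (d : ℤ) := by
  have hle : (2 : ℤ) ^ Nat.log 2 d ≤ d := by
    exact_mod_cast Nat.pow_log_le_self 2 (by omega : d ≠ 0)
  have hlt : (d : ℤ) < 2 ^ Nat.log 2 d * 2 := by
    exact_mod_cast Nat.lt_pow_succ_log_self one_lt_two d
  have hrange : {s : ℤ | ∃ y : ℕ → ℤ, (∀ k, y k = 0 ∨ y k = 1) ∧
        s = ∑ k ∈ Finset.range (Nat.log 2 d), 2 ^ k * y k +
          ((d : ℤ) + 1 - 2 ^ (Nat.log 2 d)) * y (Nat.log 2 d)} =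
      {s : ℤ | 0 ≤ s ∧ s ≤ (d : ℤ)} := by
    ext s
    constructor
    · rintro ⟨y, hy, rfl⟩
      obtain ⟨h0, h1⟩ := binary_sum_range_mem_Ico hy (Nat.log 2 d)
      rcases hy (Nat.log 2 d) with h | h <;> rw [h] <;> constructor <;> linarith
    · rintro ⟨h0, h1⟩
      rcases lt_or_ge s (2 ^ Nat.log 2 d) with h | h
      · obtain ⟨y, hy, hsum, htop⟩ := exists_binary_sum_range h0 h (Or.inl rfl)
        exact ⟨y, hy, by rw [hsum, htop]; ring⟩
      · obtain ⟨y, hy, hsum, htop⟩ := exists_binary_sum_range (n := Nat.log 2 d)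
          (s := s - (d + 1 - 2 ^ Nat.log 2 d)) (by linarith) (by linarith) (Or.inr rfl)
        exact ⟨y, hy, by rw [hsum, htop]; ring⟩
  refine ⟨hrange, ?_⟩
  rw [hrange]
  exact ⟨⟨by positivity, le_rfl⟩, fun s hs => hs.2⟩
end

section
/- Let d ≥ 2 be a natural number, let L = ⌊log₂ d⌋, and let a be an integer with 0 ≤ a ≤ d + 1. Define S(y) = Σ_{k=0}^{L−1} 2^k · y_k + (d + 1 − 2^L) · y_L for binary y_0, …, y_L ∈ {0,1}. Then there exists y ∈ {0,1}^{L+1} with 1 − a + S(y) = 0 if and only if a ≥ 1. Consequently, the Pan–Lu penalty term (1 − a + S(y))² can be made zero by a choice of surplus variables exactly when the domination constraint a ≥ 1 holds. -/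
open Finset

theorem sum_two_pow_mul_div_mod_two (n L : ℕ) :
    ∑ k ∈ Finset.range L, 2 ^ k * (n / 2 ^ k % 2) = n % 2 ^ L := by
  induction L with
  | zero => simp [Nat.mod_one]
  | succ L ih => rw [Finset.sum_range_succ, ih, Nat.mod_pow_succ]

/-- Every integer in `[0, 2 ^ L)` has a binary expansion of length `L`, with the digit at
position `L` free to be any prescribed bit. -/
theorem exists_binary_digits_sum_eq (L : ℕ) (m b : ℤ) (hm0 : 0 ≤ m) (hm : m < 2 ^ L)
    (hb : b = 0 ∨ b = 1) :
    ∃ y : ℕ → ℤ, (∀ k, y k = 0 ∨ y k = 1) ∧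
      ∑ k ∈ Finset.range L, 2 ^ k * y k = m ∧ y L = b := by
  lift m to ℕ using hm0
  have hm' : m < 2 ^ L := by exact_mod_cast hm
  refine ⟨Function.update (fun k => ((m / 2 ^ k % 2 : ℕ) : ℤ)) L b, fun k => ?_, ?_, by simp⟩
  · by_cases hk : k = L
    · subst hk
      simpa using hb
    · rw [Function.update_of_ne hk]
      exact_mod_cast Nat.mod_two_eq_zero_or_one (m / 2 ^ k)
  · have h := sum_two_pow_mul_div_mod_two m L
    rw [Nat.mod_eq_of_lt hm'] at h
    rw [← Nat.cast_inj (R := ℤ), Nat.cast_sum] at h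
    rw [← h]
    refine Finset.sum_congr rfl fun k hk => ?_
    rw [Function.update_of_ne (Finset.mem_range.mp hk).ne]
    push_cast
    rfl

/-- For `d ≥ 2`, `L = ⌊log₂ d⌋`, and an integer `a` with
`0 ≤ a ≤ d + 1`, with the Pan–Lu surplus expression
`S(y) = ∑_{k=0}^{L-1} 2^k y_k + (d + 1 - 2^L) y_L`, there exists a binary
`y ∈ {0,1}^{L+1}` with `1 - a + S(y) = 0` iff `a ≥ 1`; consequently the
Pan–Lu penalty term `(1 - a + S(y))²` can be made zero by a choice of surplus
variables exactly when the domination constraint `a ≥ 1` holds. -/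
theorem pan_lu_surplus_exists (d : ℕ) (hd : 2 ≤ d) (a : ℤ)
    (ha0 : 0 ≤ a) (ha1 : a ≤ (d : ℤ) + 1) :
    ((∃ y : ℕ → ℤ, (∀ k, y k = 0 ∨ y k = 1) ∧
        1 - a + (∑ k ∈ Finset.range (Nat.log 2 d), 2 ^ k * y k +
          ((d : ℤ) + 1 - 2 ^ (Nat.log 2 d)) * y (Nat.log 2 d)) = 0) ↔ 1 ≤ a) ∧
      ((∃ y : ℕ → ℤ, (∀ k, y k = 0 ∨ y k = 1) ∧
        (1 - a + (∑ k ∈ Finset.range (Nat.log 2 d), 2 ^ k * y k +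
          ((d : ℤ) + 1 - 2 ^ (Nat.log 2 d)) * y (Nat.log 2 d))) ^ 2 = 0) ↔
        1 ≤ a) := by
  have key : (∃ y : ℕ → ℤ, (∀ k, y k = 0 ∨ y k = 1) ∧
      1 - a + (∑ k ∈ Finset.range (Nat.log 2 d), 2 ^ k * y k +
        ((d : ℤ) + 1 - 2 ^ (Nat.log 2 d)) * y (Nat.log 2 d)) = 0) ↔ 1 ≤ a := by
    have hlow : (2 : ℤ) ^ Nat.log 2 d ≤ d := by
      exact_mod_cast Nat.pow_log_le_self 2 (by omega : d ≠ 0)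
    have hupp : (d : ℤ) < 2 ^ Nat.log 2 d * 2 := by
      rw [← pow_succ]
      exact_mod_cast Nat.lt_pow_succ_log_self one_lt_two d
    constructor
    · rintro ⟨y, hy, hsum⟩
      have hnonneg : ∀ k, 0 ≤ y k := fun k => by rcases hy k with h | h <;> simp [h]
      have hdigits : 0 ≤ ∑ k ∈ Finset.range (Nat.log 2 d), 2 ^ k * y k :=
        Finset.sum_nonneg fun k _ => mul_nonneg (by positivity) (hnonneg k)
      have htop : 0 ≤ ((d : ℤ) + 1 - 2 ^ Nat.log 2 d) * y (Nat.log 2 d) :=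
        mul_nonneg (by linarith) (hnonneg _)
      linarith
    · intro ha
      by_cases hlt : a - 1 < 2 ^ Nat.log 2 d
      · obtain ⟨y, hy, hsum, htop⟩ :=
          exists_binary_digits_sum_eq (Nat.log 2 d) (a - 1) 0 (by linarith) hlt (Or.inl rfl)
        exact ⟨y, hy, by rw [hsum, htop]; ring⟩
      · obtain ⟨y, hy, hsum, htop⟩ :=
          exists_binary_digits_sum_eq (Nat.log 2 d) (a - 1 - (d + 1 - 2 ^ Nat.log 2 d)) 1
            (by linarith) (by linarith) (Or.inr rfl)
        exact ⟨y, hy, by rw [hsum, htop]; ring⟩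
  refine ⟨key, ?_⟩
  simpa only [sq_eq_zero_iff] using key
end
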